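/- arXiv:2408.15353 — 2 statements merged into one kernel-verified Lean document; each statement's English description precedes it below -/
import Mathlib

section
/- Let G be a simple graph on a finite vertex set and let I be a set of vertices with |I| = h ≥ 2 that forms a clique in G (every two distinct vertices of I are adjacent). Then for every v ∈ I the number of neighbors of v outside I equals deg(v) - (h - 1), and consequently (1/h)·∑_{v∈I} S_v/(deg(v)+1) = 1 - ∑_{v∈I} 1/(deg(v)+1), where S_v is the number of neighbors of v outside I. Hence the effective reproductive number R_t = (β/γ)·(1/h)·∑_{v∈I} S_v/(deg(v)+1) attains its lower bound (β/γ)·(1 - ∑_{v∈I} 1/(deg(v)+1)) when the infected nodes form a complete subgraph. -/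
/-- If the infected set I (of size h ≥ 2) is a clique, then each
v ∈ I has exactly deg v - (h - 1) neighbors outside I, the averaged sum equals
1 - ∑_{v∈I} 1/(deg v + 1), and hence R_t attains its lower bound. -/
theorem stmt_5 {V : Type*} [Fintype V] [DecidableEq V] (G : SimpleGraph V)
    [DecidableRel G.Adj] (β γ : ℝ) (hβ : 0 < β) (hγ : 0 < γ)
    (I : Finset V) (h : ℕ) (hcard : I.card = h) (hh : 2 ≤ h)
    (hclique : ∀ u ∈ I, ∀ v ∈ I, u ≠ v → G.Adj u v) :
    (∀ v ∈ I, ((G.neighborFinset v \ I).card : ℤ) = (G.degree v : ℤ) - ((h : ℤ) - 1)) ∧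
      (1 / (h : ℝ)) * ∑ v ∈ I, ((G.neighborFinset v \ I).card : ℝ) / (G.degree v + 1) =
        1 - ∑ v ∈ I, 1 / ((G.degree v : ℝ) + 1) ∧
      (β / γ) * ((1 / (h : ℝ)) * ∑ v ∈ I, ((G.neighborFinset v \ I).card : ℝ) / (G.degree v + 1)) =
        (β / γ) * (1 - ∑ v ∈ I, 1 / ((G.degree v : ℝ) + 1)) := by
  have key : ∀ v ∈ I, (G.neighborFinset v \ I).card + h = G.degree v + 1 := by
    intro v hv
    have h1 : G.neighborFinset v ∩ I = I.erase v := by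
      ext u
      simp only [Finset.mem_inter, SimpleGraph.mem_neighborFinset, Finset.mem_erase]
      constructor
      · rintro ⟨ha, hu⟩
        exact ⟨ha.ne', hu⟩
      · rintro ⟨hne, hu⟩
        exact ⟨hclique v hv u hu (Ne.symm hne), hu⟩
    have h2 := Finset.card_sdiff_add_card_inter (G.neighborFinset v) I
    have h3 := Finset.card_erase_add_one hv
    rw [h1, SimpleGraph.card_neighborFinset_eq_degree] at h2
    omega
  have hpos : (h : ℝ) ≠ 0 := by
    have : h ≠ 0 := by omega
    exact_mod_cast this
  have main : (1 / (h : ℝ)) * ∑ v ∈ I, ((G.neighborFinset v \ I).card : ℝ) / (G.degree v + 1) =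
        1 - ∑ v ∈ I, 1 / ((G.degree v : ℝ) + 1) := by
    have hs : ∑ v ∈ I, ((G.neighborFinset v \ I).card : ℝ) / (G.degree v + 1) =
        ∑ v ∈ I, (1 - (h : ℝ) * (1 / ((G.degree v : ℝ) + 1))) := by
      refine Finset.sum_congr rfl fun v hv => ?_
      have hk : ((G.neighborFinset v \ I).card : ℝ) + h = G.degree v + 1 := by
        exact_mod_cast key v hv
      have hd : (G.degree v : ℝ) + 1 ≠ 0 := by positivity
      rw [eq_sub_of_add_eq hk]
      field_simp
    rw [hs, Finset.sum_sub_distrib, ← Finset.mul_sum, Finset.sum_const, hcard, nsmul_eq_mul]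
    field_simp
  refine ⟨fun v hv => ?_, main, by rw [main]⟩
  have := key v hv
  omega
end

section
/- Let G be a simple graph on a finite vertex set of size N and let I be a set of vertices with |I| = h ≥ 2 such that every vertex of I has exactly one neighbor in I and every vertex v ∈ I satisfies deg(v) ≥ 2N/h - 1. Then (1/h)·∑_{v∈I} S_v/(deg(v)+1) ≥ 1 - h/N, where S_v is the number of neighbors of v outside I. Consequently, for any β > 0 and γ > 0, the effective reproductive number of the network spreading process, R_t = (β/γ)·(1/h)·∑_{v∈I} S_v/(deg(v)+1), is at least the effective reproductive number of the mass-action model, R_t^C = (β/γ)·(1 - h/N); that is, on a finite network the epidemic can be more aggressive than under the mass-action model. -/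
/-- On a graph with N vertices, if the infected set I (of size
h ≥ 2) has every vertex with exactly one neighbor in I and every v ∈ I has
degree ≥ 2N/h - 1, then (1/h) ∑ S_v/(deg v + 1) ≥ 1 - h/N, and hence the
network effective reproductive number is at least the mass-action one. -/
theorem stmt_7 {V : Type*} [Fintype V] [DecidableEq V] (G : SimpleGraph V)
    [DecidableRel G.Adj] (N : ℕ) (hN : Fintype.card V = N)
    (I : Finset V) (h : ℕ) (hcard : I.card = h) (hh : 2 ≤ h)
    (hone : ∀ v ∈ I, (I.filter (fun u => G.Adj v u)).card = 1)
    (hdeg : ∀ v ∈ I, (G.degree v : ℝ) ≥ 2 * (N : ℝ) / (h : ℝ) - 1) :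
    (1 / (h : ℝ)) * ∑ v ∈ I, ((G.neighborFinset v \ I).card : ℝ) / (G.degree v + 1) ≥
        1 - (h : ℝ) / N ∧
      ∀ β γ : ℝ, 0 < β → 0 < γ →
        (β / γ) * ((1 / (h : ℝ)) * ∑ v ∈ I, ((G.neighborFinset v \ I).card : ℝ) / (G.degree v + 1)) ≥
          (β / γ) * (1 - (h : ℝ) / N) := by
  have hle : I.card ≤ Fintype.card V := Finset.card_le_univ I
  have hNpos : (0 : ℝ) < N := by
    have : 0 < N := by omega
    exact_mod_cast this
  have hhpos : (0 : ℝ) < h := by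
    have : 0 < h := by omega
    exact_mod_cast this
  have key : ∀ v ∈ I, 1 - (h : ℝ) / N ≤
      ((G.neighborFinset v \ I).card : ℝ) / (G.degree v + 1) := by
    intro v hv
    have h1 : (G.neighborFinset v ∩ I).card = 1 := by
      rw [← hone v hv]
      congr 1
      ext u
      simp [and_comm]
    have h2 : (G.neighborFinset v \ I).card + (G.neighborFinset v ∩ I).card = G.degree v := by
      rw [Finset.card_sdiff_add_card_inter, SimpleGraph.card_neighborFinset_eq_degree]
    have h3 : ((G.neighborFinset v \ I).card : ℝ) + 1 = G.degree v := by
      rw [h1] at h2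
      exact_mod_cast h2
    have h4 : ((G.neighborFinset v \ I).card : ℝ) = G.degree v - 1 := by linarith
    rw [h4]
    have hd := hdeg v hv
    have h5 : 2 * (N : ℝ) / h ≤ G.degree v + 1 := by linarith
    rw [div_le_iff₀ hhpos] at h5
    have hp : (0 : ℝ) < (G.degree v : ℝ) + 1 := by positivity
    rw [le_div_iff₀ hp]
    have h6 : 2 ≤ (h : ℝ) / N * (G.degree v + 1) := by
      rw [div_mul_eq_mul_div, le_div_iff₀ hNpos]
      linarith
    linarith
  have main : (1 / (h : ℝ)) * ∑ v ∈ I, ((G.neighborFinset v \ I).card : ℝ) / (G.degree v + 1) ≥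
      1 - (h : ℝ) / N := by
    have hs := Finset.card_nsmul_le_sum I _ _ key
    rw [hcard, nsmul_eq_mul] at hs
    rw [ge_iff_le, one_div, ← div_eq_inv_mul, le_div_iff₀ hhpos]
    linarith
  exact ⟨main, fun β γ hβ hγ => mul_le_mul_of_nonneg_left main (div_pos hβ hγ).le⟩
end
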